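/- Let E be a spectral effect algebra possessing a separating set of states. Then: (i) for every q ∈ P and a ∈ E, a ∈ C(q) if and only if p_{a,λ(w)} ∈ C(q) for every binary string w; (ii) if a, b ∈ E have the same binary spectral resolution, i.e. p_{a,λ(w)} = p_{b,λ(w)} for every binary string w, then a = b. -/

import Mathlib

/- Common definitions: effect algebras, compression bases, spectrality -/

attribute [local instance 0] Classical.propDecidable

universe u

structure EffectAlgebra (E : Type u) where
  padd : E → E → Option E
  zero : E
  one : E
  comm : ∀ a b, padd a b = padd b a
  assoc : ∀ a b c ab abc, padd a b = some ab → padd ab c = some abc →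
      ∃ bc, padd b c = some bc ∧ padd a bc = some abc
  orth_exists : ∀ a, ∃ x, padd a x = some one
  orth_unique : ∀ a x y, padd a x = some one → padd a y = some one → x = y
  add_one : ∀ a b, padd a one = some b → a = zero

namespace EffectAlgebra

variable {E : Type u} (EA : EffectAlgebra E)

/-- `a ⊥ b` and `a ⊕ b = c`. -/
def le (a b : E) : Prop := ∃ c, EA.padd a c = some b

/-- the orthosupplement `a'`. -/
noncomputable def compl (a : E) : E := (EA.orth_exists a).choose

/-- `b ⊖ a` (the element `c` with `a ⊕ c = b`, when it exists). -/
noncomputable def osub (b a : E) : E :=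
  if h : ∃ c, EA.padd a c = some b then h.choose else EA.zero

/-- the value of `a ⊕ b` (defaulting to `0` when undefined). -/
noncomputable def oplusD (a b : E) : E := (EA.padd a b).getD EA.zero

def IsSharp (a : E) : Prop := ∀ x, EA.le x a → EA.le x (EA.compl a) → x = EA.zero

/-- sub-effect algebra. -/
def SubEA (P : Set E) : Prop :=
  EA.zero ∈ P ∧ EA.one ∈ P ∧ (∀ a ∈ P, EA.compl a ∈ P) ∧
    ∀ a ∈ P, ∀ b ∈ P, ∀ c, EA.padd a b = some c → c ∈ P

/-- Mackey compatibility: `a = a₁ ⊕ c`, `b = b₁ ⊕ c` with `a₁ ⊕ b₁ ⊕ c` defined. -/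
def Mackey (a b : E) : Prop :=
  ∃ a1 b1 c d e, EA.padd a1 b1 = some d ∧ EA.padd d c = some e ∧
    EA.padd a1 c = some a ∧ EA.padd b1 c = some b

def Additive (J : E → E) : Prop :=
  ∀ a b c, EA.padd a b = some c → EA.padd (J a) (J b) = some (J c)

def Retraction (J : E → E) : Prop :=
  EA.Additive J ∧ ∀ a, EA.le a (J EA.one) → J a = a

def Compression (J : E → E) : Prop :=
  EA.Retraction J ∧ ∀ a, (J a = EA.zero ↔ EA.le a (EA.compl (J EA.one)))

/-- `I` is a supplement of `J`: `Ker J = ran I` and `Ker I = ran J`. -/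
def Supplement (I J : E → E) : Prop :=
  (∀ a, J a = EA.zero ↔ ∃ b, I b = a) ∧ (∀ a, I a = EA.zero ↔ ∃ b, J b = a)

/-- the `n`-fold sum `n·a`, when defined. -/
def nsmulE : ℕ → E → Option E
  | 0, _ => some EA.zero
  | n + 1, a => (nsmulE n a).bind fun b => EA.padd a b

def ArchimedeanEA : Prop :=
  ∀ a : E, (∀ n : ℕ, ∃ b, EA.nsmulE n a = some b) → a = EA.zero

/-- a state on an effect algebra. -/
def IsState (s : E → ℝ) : Prop :=
  s EA.one = 1 ∧ (∀ a, 0 ≤ s a ∧ s a ≤ 1) ∧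
    ∀ a b c, EA.padd a b = some c → s c = s a + s b

noncomputable def partialSum (f : ℕ → E) : ℕ → E
  | 0 => EA.zero
  | n + 1 => EA.oplusD (partialSum f n) (f n)

/-- σ-additivity of a state: if all partial sums of an orthogonal sequence are defined
and the orthosum (= supremum of the partial sums) exists, the state is countably additive. -/
def SigmaAdditive (s : E → ℝ) : Prop :=
  ∀ f : ℕ → E, ∀ b : E,
    (∀ n, ∃ c, EA.padd (EA.partialSum f n) (f n) = some c) →
    (∀ n, EA.le (EA.partialSum f n) b) →
    (∀ c, (∀ n, EA.le (EA.partialSum f n) c) → EA.le b c) →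
    Filter.Tendsto (fun n => ∑ i ∈ Finset.range n, s (f i)) Filter.atTop (nhds (s b))

/-- A compression base: a family of compressions indexed by a sub-effect algebra `P`
such that each `p ∈ P` is the focus of `J p`, and Mackey compatible projections
compose to a projection. -/
structure CompressionBase {E : Type u} (EA : EffectAlgebra E) where
  P : Set E
  J : E → E → E
  sub : EA.SubEA P
  compr : ∀ p ∈ P, EA.Compression (J p)
  focus : ∀ p ∈ P, J p EA.one = p
  mackey : ∀ p ∈ P, ∀ q ∈ P, EA.Mackey p q → ∃ r ∈ P, J p ∘ J q = J r

variable (CB : CompressionBase EA)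

/-- `a ∈ C(p)`:  `a = J_p(a) ⊕ J_{p'}(a)`. -/
def inC (a p : E) : Prop :=
  EA.padd (CB.J p a) (CB.J (EA.compl p) a) = some a

/-- `PC(a) = {p ∈ P : a ∈ C(p)}`. -/
def PC (a : E) : Set E := {p | p ∈ CB.P ∧ inC EA CB a p}

/-- the bicommutant `P(a)`. -/
def bicomm (a : E) : Set E :=
  {p | p ∈ PC EA CB a ∧ ∀ q ∈ PC EA CB a, inC EA CB p q}

/-- `PC(A)` for a set `A ⊆ E`. -/
def PCset (A : Set E) : Set E := {p | p ∈ CB.P ∧ ∀ a ∈ A, inC EA CB a p}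

/-- `P(Q) = PC(PC(Q) ∪ Q)`. -/
def Pset (Q : Set E) : Set E := PCset EA CB (PCset EA CB Q ∪ Q)

/-- `P_≤(e,f)`. -/
def Ple (e f : E) : Set E :=
  {p | p ∈ Pset EA CB {e, f} ∧ EA.le (CB.J p e) (CB.J p f) ∧
    EA.le (CB.J (EA.compl p) f) (CB.J (EA.compl p) e)}

/-- a Boolean subalgebra of `P`: a sub-effect algebra of `E` contained in `P`
whose elements are pairwise Mackey compatible, with witnesses inside. -/
def BooleanSub (B : Set E) : Prop :=
  B ⊆ CB.P ∧ EA.SubEA B ∧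
    ∀ p ∈ B, ∀ q ∈ B, ∃ p1 ∈ B, ∃ q1 ∈ B, ∃ c ∈ B, ∃ d e,
      EA.padd p1 q1 = some d ∧ EA.padd d c = some e ∧
      EA.padd p1 c = some p ∧ EA.padd q1 c = some q

/-- `a` is a b-element with associated Boolean subalgebra `B`. -/
def IsBElementWith (a : E) (B : Set E) : Prop :=
  BooleanSub EA CB B ∧ ∀ p ∈ CB.P, (inC EA CB a p ↔ ∀ b ∈ B, inC EA CB b p)

def IsBElement (a : E) : Prop := ∃ B, IsBElementWith EA CB a B

def BProperty : Prop := ∀ a : E, IsBElement EA CB a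

/-- commuting of b-elements: `e C f` iff `P(e) ↔ P(f)`. -/
def CommuteEl (e f : E) : Prop :=
  ∀ p ∈ bicomm EA CB e, ∀ q ∈ bicomm EA CB f, EA.Mackey p q

def BComparability : Prop :=
  BProperty EA CB ∧ ∀ e f : E, CommuteEl EA CB e f → (Ple EA CB e f).Nonempty

def IsProjCover (a p : E) : Prop :=
  p ∈ CB.P ∧ ∀ q ∈ CB.P, (EA.le a q ↔ EA.le p q)

def ProjCoverProp : Prop := ∀ a : E, ∃ p, IsProjCover EA CB a p

def Spectral : Prop := ProjCoverProp EA CB ∧ BComparability EA CB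

/-- a block of `P`: a maximal set of pairwise Mackey compatible projections. -/
def IsBlock (B : Set E) : Prop :=
  B ⊆ CB.P ∧ (∀ p ∈ B, ∀ q ∈ B, EA.Mackey p q) ∧
    ∀ B' : Set E, B' ⊆ CB.P → (∀ p ∈ B', ∀ q ∈ B', EA.Mackey p q) → B ⊆ B' → B' = B

/-- the C-block `C(B)`. -/
def Cblock (B : Set E) : Set E := {a | ∀ p ∈ B, inC EA CB a p}

/-- `(f − e)_+` (the positive part, defined when `P_≤(e,f)` is nonempty). -/
noncomputable def posPart (e f : E) : E :=
  if h : (Ple EA CB e f).Nonempty then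
    EA.osub (CB.J h.some f) (CB.J h.some e)
  else EA.zero

noncomputable def projCover (a : E) : E :=
  if h : ∃ p, IsProjCover EA CB a p then h.choose else EA.zero

def IsMeetP (p q m : E) : Prop :=
  m ∈ CB.P ∧ EA.le m p ∧ EA.le m q ∧ ∀ s ∈ CB.P, EA.le s p → EA.le s q → EA.le s m

/-- `p ∧ q` in `P`. -/
noncomputable def pmeet (p q : E) : E :=
  if h : ∃ m, IsMeetP EA CB p q m then h.choose else EA.zero

/-- infimum of a set of projections in `P`. -/
def IsInfP (S : Set E) (m : E) : Prop :=
  m ∈ CB.P ∧ (∀ s ∈ S, EA.le m s) ∧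
    ∀ t ∈ CB.P, (∀ s ∈ S, EA.le t s) → EA.le t m

/-! Relative (to a projection `q`, i.e. computed in the interval `[0,q]`) notions. -/

def Pq (q : E) : Set E := {p | p ∈ CB.P ∧ EA.le p q}

def inCq (q a p : E) : Prop :=
  EA.padd (CB.J p a) (CB.J (EA.osub q p) a) = some a

def PCq (q a : E) : Set E := {p | p ∈ Pq EA CB q ∧ inCq EA CB q a p}

def bicommq (q a : E) : Set E :=
  {p | p ∈ PCq EA CB q a ∧ ∀ r ∈ PCq EA CB q a, inCq EA CB q p r}

def PCsetq (q : E) (A : Set E) : Set E :=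
  {p | p ∈ Pq EA CB q ∧ ∀ a ∈ A, inCq EA CB q a p}

def Psetq (q : E) (Q : Set E) : Set E := PCsetq EA CB q (PCsetq EA CB q Q ∪ Q)

def Pleq (q e f : E) : Set E :=
  {p | p ∈ Psetq EA CB q {e, f} ∧ EA.le (CB.J p e) (CB.J p f) ∧
    EA.le (CB.J (EA.osub q p) f) (CB.J (EA.osub q p) e)}

noncomputable def posPartq (q e f : E) : E :=
  if h : (Pleq EA CB q e f).Nonempty then
    EA.osub (CB.J h.some f) (CB.J h.some e)
  else EA.zero

def IsProjCoverq (q a p : E) : Prop :=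
  p ∈ Pq EA CB q ∧ ∀ s ∈ Pq EA CB q, (EA.le a s ↔ EA.le p s)

noncomputable def projCoverq (q a : E) : E :=
  if h : ∃ p, IsProjCoverq EA CB q a p then h.choose else EA.zero

def Mackeyq (q a b : E) : Prop :=
  ∃ a1 b1 c d e, EA.padd a1 b1 = some d ∧ EA.padd d c = some e ∧ EA.le e q ∧
    EA.padd a1 c = some a ∧ EA.padd b1 c = some b

def SubEAq (q : E) (F : Set E) : Prop :=
  EA.zero ∈ F ∧ q ∈ F ∧ (∀ x ∈ F, EA.osub q x ∈ F) ∧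
    ∀ x ∈ F, ∀ y ∈ F, ∀ z, EA.padd x y = some z → EA.le z q → z ∈ F

def BooleanSubq (q : E) (B : Set E) : Prop :=
  B ⊆ Pq EA CB q ∧ SubEAq EA q B ∧
    ∀ p ∈ B, ∀ r ∈ B, ∃ p1 ∈ B, ∃ r1 ∈ B, ∃ c ∈ B, ∃ d e,
      EA.padd p1 r1 = some d ∧ EA.padd d c = some e ∧ EA.le e q ∧
      EA.padd p1 c = some p ∧ EA.padd r1 c = some r

def IsBElementq (q a : E) : Prop :=
  ∃ B, BooleanSubq EA CB q B ∧
    ∀ p ∈ Pq EA CB q, (inCq EA CB q a p ↔ ∀ b ∈ B, inCq EA CB q b p)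

def BPropertyq (q : E) : Prop := ∀ a : E, EA.le a q → IsBElementq EA CB q a

def CommuteElq (q e f : E) : Prop :=
  ∀ p ∈ bicommq EA CB q e, ∀ r ∈ bicommq EA CB q f, Mackeyq EA q p r

def BComparabilityq (q : E) : Prop :=
  BPropertyq EA CB q ∧ ∀ e f : E, EA.le e q → EA.le f q →
    CommuteElq EA CB q e f → (Pleq EA CB q e f).Nonempty

/-! The binary spectral resolution. -/

/-- `λ(w) = Σ_j w_j 2^{-j}` (head of the list is the first digit). -/
def lamOf : List Bool → ℚ
  | [] => 0
  | b :: t => ((if b then 1 else 0) + lamOf t) / 2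

/-- all binary strings of length `n`, in lexicographic order. -/
def allStrings : ℕ → List (List Bool)
  | 0 => [[]]
  | n + 1 => (allStrings n).flatMap fun w => [w ++ [false], w ++ [true]]

noncomputable def listSum (l : List E) : E :=
  l.foldl (fun acc x => EA.oplusD acc x) EA.zero

/-- the families `(u_w, c_w)`; the binary string is given in reversed order
(head of the list is the last digit). -/
noncomputable def ucAux (a : E) : List Bool → E × E
  | [] => (projCover EA CB a, a)
  | bit :: t =>
      let p := ucAux a t
      let q := p.1
      let cw := p.2
      let cw' := EA.osub q cw
      let d := posPartq EA CB q cw' cw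
      let u0 := pmeet EA CB (EA.osub q (projCoverq EA CB q d)) q
      if bit then (pmeet EA CB q (EA.compl u0), d)
      else (u0, EA.oplusD (CB.J u0 cw) (CB.J u0 cw))

noncomputable def uw (a : E) (w : List Bool) : E := (ucAux EA CB a w.reverse).1

noncomputable def cw (a : E) (w : List Bool) : E := (ucAux EA CB a w.reverse).2

/-- the binary spectral projection `p_{a,λ(w1)}`. -/
noncomputable def pbin (a : E) (w : List Bool) : E :=
  listSum EA (EA.compl (projCover EA CB a) ::
    (((allStrings (w.length + 1)).filter
        fun v => lamOf v ≤ lamOf (w ++ [false])).map (uw EA CB a)))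

def Dyadic01 (x : ℚ) : Prop := ∃ n k : ℕ, (k : ℚ) ≤ 2 ^ n ∧ x = (k : ℚ) / 2 ^ n

/-- the binary spectral resolution `p_{a,λ}`, for dyadic rationals `λ ∈ [0,1]`. -/
noncomputable def pdyad (a : E) (x : ℚ) : E :=
  if x ≤ 0 then EA.compl (projCover EA CB a)
  else if 1 ≤ x then EA.one
  else if h : ∃ w : List Bool, lamOf (w ++ [true]) = x then pbin EA CB a h.choose
  else EA.zero

/-- the rational spectral resolution `p_{a,λ} = ⋀_{μ > λ, μ dyadic} p_{a,μ}`. -/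
noncomputable def ratRes (a : E) (x : ℚ) : E :=
  if h : ∃ m, IsInfP EA CB {y | ∃ μ, Dyadic01 μ ∧ x < μ ∧ y = pdyad EA CB a μ} m
  then h.choose else EA.zero

/-- the partial maps `f_0(b) = 2b`, `f_1(b) = (2b')'` computed in `[0,uu]`. -/
noncomputable def fstep (uu b : E) (bit : Bool) : Option E :=
  if bit then
    (if EA.le (EA.osub uu b) b
      then some (EA.osub uu (EA.oplusD (EA.osub uu b) (EA.osub uu b))) else none)
  else
    (if EA.le b (EA.osub uu b) then some (EA.oplusD b b) else none)

/-- `f_w = f_{w_n} ∘ ⋯ ∘ f_{w_1}`, computed in `[0,uu]`, as a partial map. -/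
noncomputable def fword (uu : E) (w : List Bool) (b : E) : Option E :=
  w.foldl (fun ob bit => ob.bind fun x => fstep EA uu x bit) (some b)

/-! ### Helper lemmas -/

section helpers

variable {EA} {CB}

theorem assoc' {a b c bc abc : E} (h1 : EA.padd b c = some bc) (h2 : EA.padd a bc = some abc) :
    ∃ ab, EA.padd a b = some ab ∧ EA.padd ab c = some abc := by
  rw [EA.comm] at h1 h2
  obtain ⟨x, hx, hy⟩ := EA.assoc _ _ _ _ _ h1 h2
  exact ⟨x, by rw [EA.comm]; exact hx, by rw [EA.comm]; exact hy⟩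

theorem one_zero : EA.padd EA.one EA.zero = some EA.one := by
  obtain ⟨x, hx⟩ := EA.orth_exists EA.one
  have := EA.add_one x _ (by rw [EA.comm]; exact hx)
  rw [← this]; exact hx

theorem compl_spec (a : E) : EA.padd a (EA.compl a) = some EA.one :=
  (EA.orth_exists a).choose_spec

theorem add_zero (a : E) : EA.padd a EA.zero = some a := by
  have h : EA.padd (EA.compl a) a = some EA.one := by rw [EA.comm]; exact compl_spec a
  obtain ⟨y, hy, hz⟩ := EA.assoc _ _ _ _ _ h one_zero
  rw [hy, EA.orth_unique _ _ _ hz h]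

theorem zero_add (a : E) : EA.padd EA.zero a = some a := by
  rw [EA.comm]; exact add_zero a

theorem cancel {a b b2 c : E} (h1 : EA.padd a b = some c) (h2 : EA.padd a b2 = some c) :
    b = b2 := by
  have hc := compl_spec (EA := EA) c
  have hc' : EA.padd (EA.compl c) c = some EA.one := by rw [EA.comm]; exact hc
  obtain ⟨x, hx, hx'⟩ := assoc' h1 hc'
  obtain ⟨y, hy, hy'⟩ := assoc' h2 hc'
  rw [hx] at hy
  cases hy
  exact EA.orth_unique _ _ _ hx' hy'

theorem eq_zero_of_add {a b : E} (h : EA.padd a b = some EA.zero) : a = EA.zero := by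
  rw [EA.comm] at h
  obtain ⟨x, hx, _⟩ := EA.assoc _ _ _ _ _ h (zero_add EA.one)
  exact EA.add_one _ _ hx

theorem le_rfl' (a : E) : EA.le a a := ⟨_, add_zero a⟩

theorem le_tr {a b c : E} (h1 : EA.le a b) (h2 : EA.le b c) : EA.le a c := by
  obtain ⟨x, hx⟩ := h1
  obtain ⟨y, hy⟩ := h2
  obtain ⟨z, _, hz⟩ := EA.assoc _ _ _ _ _ hx hy
  exact ⟨z, hz⟩

theorem le_anti {a b : E} (h1 : EA.le a b) (h2 : EA.le b a) : a = b := by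
  obtain ⟨x, hx⟩ := h1
  obtain ⟨y, hy⟩ := h2
  obtain ⟨z, hz, hz'⟩ := EA.assoc _ _ _ _ _ hx hy
  have : z = EA.zero := cancel hz' (add_zero a)
  subst this
  have := eq_zero_of_add hz
  subst this
  rw [add_zero] at hx
  exact Option.some.inj hx

theorem le_left {a b c : E} (h : EA.padd a b = some c) : EA.le a c := ⟨b, h⟩

theorem le_right {a b c : E} (h : EA.padd a b = some c) : EA.le b c := ⟨a, by rw [EA.comm]; exact h⟩

theorem le_one (a : E) : EA.le a EA.one := ⟨_, compl_spec a⟩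

theorem zero_le (a : E) : EA.le EA.zero a := ⟨_, zero_add a⟩

theorem compl_unique {a b : E} (h : EA.padd a b = some EA.one) : b = EA.compl a :=
  EA.orth_unique _ _ _ h (compl_spec a)

theorem compl_compl' (a : E) : EA.compl (EA.compl a) = a :=
  (compl_unique (by rw [EA.comm]; exact compl_spec a)).symm

theorem osub_spec {a b : E} (h : EA.le a b) : EA.padd a (EA.osub b a) = some b := by
  have h' : ∃ c, EA.padd a c = some b := h
  rw [osub, dif_pos h']
  exact h'.choose_spec

theorem osub_eq {a b c : E} (h : EA.padd a c = some b) : EA.osub b a = c :=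
  cancel (osub_spec ⟨c, h⟩) h

theorem orth_le {a b c : E} (h : EA.padd a b = some c) : EA.le a (EA.compl b) := by
  rw [EA.comm] at h
  obtain ⟨x, hx, hx'⟩ := EA.assoc _ _ _ _ _ h (compl_spec c)
  rw [← compl_unique hx']
  exact le_left hx

theorem orth_of_le {a b : E} (h : EA.le a (EA.compl b)) : ∃ c, EA.padd a b = some c := by
  obtain ⟨x, hx⟩ := h
  obtain ⟨y, hy, _⟩ := assoc' hx (compl_spec b)
  exact ⟨y, by rw [EA.comm]; exact hy⟩

theorem compl_anti {a b : E} (h : EA.le a b) : EA.le (EA.compl b) (EA.compl a) := by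
  rw [← compl_compl' (EA := EA) b] at h
  obtain ⟨c, hc⟩ := orth_of_le h
  rw [EA.comm] at hc
  exact orth_le hc

theorem orth_mono {a b a2 b2 c : E} (h : EA.padd a b = some c) (ha : EA.le a2 a)
    (hb : EA.le b2 b) : ∃ c, EA.padd a2 b2 = some c :=
  orth_of_le (le_tr ha (le_tr (orth_le h) (compl_anti hb)))

theorem four_sum {a1 b1 c1 a2 b2 c2 c : E} (h1 : EA.padd a1 b1 = some c1)
    (h2 : EA.padd a2 b2 = some c2) (h : EA.padd c1 c2 = some c) :
    ∃ x y, EA.padd a1 a2 = some x ∧ EA.padd b1 b2 = some y ∧ EA.padd x y = some c := by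
  obtain ⟨m, hm, hm'⟩ := EA.assoc _ _ _ _ _ h1 h
  rw [EA.comm] at h2
  obtain ⟨y, hy, hy'⟩ := assoc' h2 hm
  rw [EA.comm] at hy'
  obtain ⟨x, hx, hx'⟩ := assoc' hy' hm'
  exact ⟨x, y, hx, hy, hx'⟩

theorem add_le_add_l {x y z y2 z2 : E} (h1 : EA.padd x y = some z) (h2 : EA.padd x y2 = some z2)
    (h : EA.le y y2) : EA.le z z2 := by
  obtain ⟨w, hw⟩ := h
  obtain ⟨z', hz, hz'⟩ := assoc' hw h2
  rw [h1] at hz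
  cases hz
  exact ⟨w, hz'⟩

/-! compressions -/

theorem P_compl {p : E} (hp : p ∈ CB.P) : EA.compl p ∈ CB.P := CB.sub.2.2.1 p hp

theorem J_add {p : E} (hp : p ∈ CB.P) {a b c : E} (h : EA.padd a b = some c) :
    EA.padd (CB.J p a) (CB.J p b) = some (CB.J p c) := (CB.compr p hp).1.1 a b c h

theorem J_mono {p : E} (hp : p ∈ CB.P) {a b : E} (h : EA.le a b) :
    EA.le (CB.J p a) (CB.J p b) := by
  obtain ⟨c, hc⟩ := h
  exact ⟨_, J_add hp hc⟩

theorem J_le {p : E} (hp : p ∈ CB.P) (a : E) : EA.le (CB.J p a) p := by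
  have := J_mono hp (le_one (EA := EA) a)
  rwa [CB.focus p hp] at this

theorem J_fix {p : E} (hp : p ∈ CB.P) {a : E} (h : EA.le a p) : CB.J p a = a :=
  (CB.compr p hp).1.2 a (by rw [CB.focus p hp]; exact h)

theorem J_zero_iff {p : E} (hp : p ∈ CB.P) (a : E) :
    CB.J p a = EA.zero ↔ EA.le a (EA.compl p) := by
  have := (CB.compr p hp).2 a
  rwa [CB.focus p hp] at this

theorem J_above {p : E} (hp : p ∈ CB.P) {a : E} (h : EA.le p a) : CB.J p a = p := by
  apply le_anti (J_le hp a)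
  have := J_mono hp h
  rwa [J_fix hp (le_rfl' p)] at this

theorem J_orth {q : E} (hq : q ∈ CB.P) (a b : E) :
    ∃ z, EA.padd (CB.J q a) (CB.J (EA.compl q) b) = some z :=
  orth_mono (compl_spec q) (J_le hq a) (J_le (P_compl hq) b)

theorem C_add {q : E} (hq : q ∈ CB.P) {a b c : E} (ha : inC EA CB a q) (hb : inC EA CB b q)
    (h : EA.padd a b = some c) : inC EA CB c q := by
  obtain ⟨z, hz⟩ := J_orth hq c c
  obtain ⟨x, y, hx, hy, hxy⟩ := four_sum (J_add hq h) (J_add (P_compl hq) h) hz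
  unfold inC at *
  rw [ha] at hx; rw [hb] at hy
  cases hx; cases hy
  rw [h] at hxy
  rw [hz, hxy]

theorem C_sub {q : E} (hq : q ∈ CB.P) {a b c : E} (ha : inC EA CB a q) (hc : inC EA CB c q)
    (h : EA.padd a b = some c) : inC EA CB b q := by
  unfold inC at *
  obtain ⟨x, y, hx, hy, hxy⟩ := four_sum (J_add hq h) (J_add (P_compl hq) h) hc
  rw [ha] at hx
  cases hx
  rw [hy, cancel hxy h]

theorem C_le {q : E} (hq : q ∈ CB.P) {a : E} (h : EA.le a q) : inC EA CB a q := by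
  unfold inC
  rw [J_fix hq h, (J_zero_iff (P_compl hq) a).2 (by rw [compl_compl']; exact h)]
  exact add_zero a

theorem C_le' {q : E} (hq : q ∈ CB.P) {a : E} (h : EA.le a (EA.compl q)) : inC EA CB a q := by
  unfold inC
  rw [J_fix (P_compl hq) h, (J_zero_iff hq a).2 h]
  exact zero_add a

theorem C_one {q : E} (hq : q ∈ CB.P) : inC EA CB EA.one q :=
  C_add hq (C_le hq (le_rfl' q)) (C_le' hq (le_rfl' _)) (compl_spec q)

theorem C_compl {q : E} (hq : q ∈ CB.P) {a : E} (h : inC EA CB a q) :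
    inC EA CB (EA.compl a) q := C_sub hq h (C_one hq) (compl_spec a)

theorem C_compl_r {q a : E} (h : inC EA CB a q) :
    inC EA CB a (EA.compl q) := by
  unfold inC at *
  rw [compl_compl', EA.comm]; exact h

theorem Mackey_symm {p q : E} (h : EA.Mackey p q) : EA.Mackey q p := by
  obtain ⟨a, b, c, d, e, h1, h2, h3, h4⟩ := h
  exact ⟨b, a, c, d, e, by rw [EA.comm]; exact h1, h2, h4, h3⟩

theorem Mackey_of_C {p q : E} (hq : q ∈ CB.P) (h : inC EA CB p q) : EA.Mackey p q := by
  have h1 := osub_spec (J_le hq p)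
  obtain ⟨z, hz⟩ := orth_mono (compl_spec q) (le_rfl' q) (J_le (P_compl hq) p)
  rw [EA.comm] at hz h1
  obtain ⟨d, hd, hd'⟩ := assoc' h1 hz
  exact ⟨_, _, _, d, z, hd, hd', by rw [EA.comm]; exact h, h1⟩

theorem C_of_Mackey {p q : E} (hq : q ∈ CB.P) (h : EA.Mackey p q) : inC EA CB p q := by
  obtain ⟨a, b, c, d, e, h1, h2, h3, h4⟩ := h
  obtain ⟨x, hx, hx'⟩ := EA.assoc _ _ _ _ _ h1 h2
  rw [h4] at hx
  cases hx
  exact C_add hq (C_le' hq (orth_le hx')) (C_le hq (le_right h4)) h3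

theorem C_symm {p q : E} (hp : p ∈ CB.P) (hq : q ∈ CB.P) (h : inC EA CB p q) :
    inC EA CB q p := C_of_Mackey hp (Mackey_symm (Mackey_of_C hq h))

theorem Mackey_J {p q : E} (hp : p ∈ CB.P) {a b c d e : E}
    (h1 : EA.padd a b = some d) (h2 : EA.padd d c = some e) (h3 : EA.padd a c = some p)
    (h4 : EA.padd b c = some q) : CB.J p q = c := by
  rw [EA.comm] at h1
  obtain ⟨x, hx, hx'⟩ := EA.assoc _ _ _ _ _ h1 h2
  rw [h3] at hx
  cases hx
  have := J_add hp h4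
  rw [(J_zero_iff hp b).2 (orth_le hx'), J_fix hp (le_right h3), zero_add] at this
  exact (Option.some.inj this).symm

theorem com {p q : E} (hp : p ∈ CB.P) (hq : q ∈ CB.P) (h : inC EA CB p q) :
    CB.J p q ∈ CB.P ∧ CB.J p q = CB.J q p ∧
      (∀ x, CB.J p (CB.J q x) = CB.J (CB.J p q) x) ∧
      (∀ x, CB.J q (CB.J p x) = CB.J (CB.J p q) x) := by
  have hM := Mackey_of_C hq h
  obtain ⟨a, b, c, d, e, h1, h2, h3, h4⟩ := id hM
  have e1 : CB.J p q = c := Mackey_J hp h1 h2 h3 h4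
  have e2 : CB.J q p = c := Mackey_J hq (by rw [EA.comm]; exact h1) h2 h4 h3
  obtain ⟨r, hr, hr'⟩ := CB.mackey p hp q hq hM
  obtain ⟨r2, hr2, hr2'⟩ := CB.mackey q hq p hp (Mackey_symm hM)
  have f1 : r = c := by
    have := congrFun hr' EA.one
    simp only [Function.comp, CB.focus _ hq, CB.focus _ hr, e1] at this
    exact this.symm
  have f2 : r2 = c := by
    have := congrFun hr2' EA.one
    simp only [Function.comp, CB.focus _ hp, CB.focus _ hr2, e2] at this
    exact this.symm
  subst f1
  subst f2
  rw [e1, e2]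
  exact ⟨hr, rfl, fun x => congrFun hr' x, fun x => congrFun hr2' x⟩

theorem C_J {p q : E} (hp : p ∈ CB.P) (hq : q ∈ CB.P) (h : inC EA CB p q) {a : E}
    (ha : inC EA CB a q) : inC EA CB (CB.J p a) q := by
  have c1 := com hp hq h
  have c2 := com hp (P_compl hq) (C_compl_r h)
  unfold inC
  rw [c1.2.2.2, ← c1.2.2.1, c2.2.2.2, ← c2.2.2.1]
  exact J_add hp ha

/-- sums of projections below a projection -/
theorem P_sub {p q r : E} (hp : p ∈ CB.P) (hq : q ∈ CB.P) (h : EA.padd p r = some q) :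
    r ∈ CB.P := by
  obtain ⟨x, hx, hx'⟩ := EA.assoc _ _ _ _ _ h (compl_spec q)
  rw [EA.comm] at hx
  obtain ⟨y, hy⟩ := orth_mono (by rw [EA.comm]; exact compl_spec q) (le_rfl' (EA.compl q))
    (le_left h)
  have hyP := CB.sub.2.2.2 _ (P_compl hq) _ hp _ hy
  obtain ⟨z, hz, hz'⟩ := EA.assoc _ _ _ _ _ (by rw [EA.comm]; exact h) (compl_spec q)
  rw [EA.comm, hy] at hz
  cases hz
  rw [EA.comm] at hz'
  rw [compl_unique hz']
  exact P_compl hyP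

theorem cover_spec (hspec : Spectral EA CB) (a : E) : IsProjCover EA CB a (projCover EA CB a) := by
  rw [projCover, dif_pos (hspec.1 a)]
  exact (hspec.1 a).choose_spec

theorem le_cover (hspec : Spectral EA CB) (a : E) : EA.le a (projCover EA CB a) :=
  ((cover_spec hspec a).2 _ (cover_spec hspec a).1).2 (le_rfl' _)

theorem cover_le (hspec : Spectral EA CB) {a q : E} (hq : q ∈ CB.P) (h : EA.le a q) :
    EA.le (projCover EA CB a) q := ((cover_spec hspec a).2 _ hq).1 h

theorem C_cover (hspec : Spectral EA CB) {d p : E} (hp : p ∈ CB.P) (h : inC EA CB d p) :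
    inC EA CB (projCover EA CB d) p := by
  have hD := (cover_spec hspec d).1
  have he := (cover_spec hspec (CB.J p d)).1
  have hf := (cover_spec hspec (CB.J (EA.compl p) d)).1
  have e1 := cover_le hspec hp (J_le hp d)
  have f1 := cover_le hspec (P_compl hp) (J_le (P_compl hp) d)
  have e2 := cover_le hspec hD (le_tr (le_left h) (le_cover hspec d))
  have f2 := cover_le hspec hD (le_tr (le_right h) (le_cover hspec d))
  obtain ⟨z, hz⟩ := orth_mono (compl_spec p) e1 f1
  have hzP := CB.sub.2.2.2 _ he _ hf _ hz
  have h1 : EA.le z (projCover EA CB d) := by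
    have := J_add hD hz
    rw [J_fix hD e2, J_fix hD f2, hz] at this
    rw [Option.some.inj this]
    exact J_le hD z
  have h2 : EA.le d z := by
    obtain ⟨x, hx⟩ := le_cover hspec (CB.J p d)
    obtain ⟨y, hy⟩ := le_cover hspec (CB.J (EA.compl p) d)
    obtain ⟨m, n, hm, _, hmn⟩ := four_sum hx hy hz
    unfold inC at h
    rw [h] at hm
    cases hm
    exact le_left hmn
  have := le_anti h1 (cover_le hspec hzP h2)
  rw [← this]
  exact C_add hp (C_le hp e1) (C_le' hp f1) hz

/-! relative notions -/

theorem rel {u q : E} (hu : u ∈ CB.P) (hq : q ∈ CB.P) (h : inC EA CB q u) :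
    CB.J u q ∈ Pq EA CB u ∧ ∀ x, EA.le x u → CB.J (CB.J u q) x = CB.J q x ∧
      CB.J (EA.osub u (CB.J u q)) x = CB.J (EA.compl q) x := by
  have c1 := com hu hq (C_symm hq hu h)
  have c2 := com hu (P_compl hq) (C_compl_r (C_symm hq hu h))
  have e : EA.osub u (CB.J u q) = CB.J u (EA.compl q) := by
    apply osub_eq
    have := J_add hu (compl_spec q)
    rwa [CB.focus u hu] at this
  refine ⟨⟨c1.1, J_le hu q⟩, fun x hx => ⟨?_, ?_⟩⟩
  · rw [← c1.2.2.2, J_fix hu hx]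
  · rw [e, ← c2.2.2.2, J_fix hu hx]

theorem inCq_iff {u q : E} (hu : u ∈ CB.P) (hq : q ∈ CB.P) (h : inC EA CB q u) {x : E}
    (hx : EA.le x u) : inCq EA CB u x (CB.J u q) ↔ inC EA CB x q := by
  unfold inCq inC
  rw [((rel hu hq h).2 x hx).1, ((rel hu hq h).2 x hx).2]

theorem inCq_iff' {u q : E} (hu : u ∈ CB.P) (hq : q ∈ CB.P) (h : EA.le q u) {x : E}
    (hx : EA.le x u) : inCq EA CB u x q ↔ inC EA CB x q := by
  have := inCq_iff hu hq (C_le hu h) hx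
  rwa [J_fix hu h] at this

theorem Pleq_nonempty (hspec : Spectral EA CB) {u c : E} (hu : u ∈ CB.P) (hc : EA.le c u) :
    (Pleq EA CB u (EA.osub u c) c).Nonempty := by
  have hs := osub_spec hc
  set c' := EA.osub u c with hc'
  have hs' : EA.padd c' c = some u := by rw [EA.comm]; exact hs
  have hc'u : EA.le c' u := le_right hs
  have hcomm : CommuteEl EA CB c' c := by
    intro p hp q hq
    have hpu := hp.2 u ⟨hu, C_le hu hc'u⟩
    have hup := C_symm hp.1.1 hu hpu
    have hcp := C_sub hp.1.1 hp.1.2 hup hs'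
    exact Mackey_symm (Mackey_of_C hp.1.1 (hq.2 p ⟨hp.1.1, hcp⟩))
  obtain ⟨p, hp, hp1, hp2⟩ := hspec.2.2 c' c hcomm
  have hpP := hp.1
  have hup : inC EA CB u p := hp.2 u (Or.inl ⟨hu, by
    rintro a (rfl | rfl)
    · exact C_le hu hc'u
    · exact C_le hu hc⟩)
  have hpu := C_symm hu hpP hup
  have hr := rel hu hpP hpu
  refine ⟨CB.J u p, ⟨hr.1, ?_⟩, ?_, ?_⟩
  · rintro a (ha | ha)
    · rw [inCq_iff hu hpP hpu ha.1.2]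
      refine hp.2 a (Or.inl ⟨ha.1.1, fun b hb => ?_⟩)
      have hbu : EA.le b u := by
        rcases hb with rfl | rfl <;> assumption
      exact (inCq_iff' hu ha.1.1 ha.1.2 hbu).1 (ha.2 b hb)
    · have hau : EA.le a u := by
        rcases ha with rfl | rfl <;> assumption
      rw [inCq_iff hu hpP hpu hau]
      exact hp.2 a (Or.inr ha)
  · rw [(hr.2 _ hc'u).1, (hr.2 _ hc).1]; exact hp1
  · rw [(hr.2 _ hc'u).2, (hr.2 _ hc).2]; exact hp2

theorem projCoverq_eq (hspec : Spectral EA CB) {u d : E} (hu : u ∈ CB.P) (hd : EA.le d u) :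
    projCoverq EA CB u d = projCover EA CB d := by
  have h0 : IsProjCoverq EA CB u d (projCover EA CB d) :=
    ⟨⟨(cover_spec hspec d).1, cover_le hspec hu hd⟩, fun s hs => (cover_spec hspec d).2 s hs.1⟩
  have h : ∃ p, IsProjCoverq EA CB u d p := ⟨_, h0⟩
  rw [projCoverq, dif_pos h]
  have h1 := h.choose_spec
  exact le_anti ((h1.2 _ h0.1).1 ((h0.2 _ h0.1).2 (le_rfl' _)))
    ((h0.2 _ h1.1).1 ((h1.2 _ h1.1).2 (le_rfl' _)))

theorem pmeet_eq {p q m : E} (h0 : IsMeetP EA CB p q m) : pmeet EA CB p q = m := by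
  have h : ∃ p', IsMeetP EA CB p q p' := ⟨_, h0⟩
  rw [pmeet, dif_pos h]
  have h1 := h.choose_spec
  exact le_anti (h0.2.2.2 _ h1.1 h1.2.1 h1.2.2.1) (h1.2.2.2 _ h0.1 h0.2.1 h0.2.2.1)

/-- the splitting step -/
theorem step (hspec : Spectral EA CB) {u c : E} (hu : u ∈ CB.P) (hc : EA.le c u) :
    ∃ d u0 u1 c0, d = posPartq EA CB u (EA.osub u c) c ∧
      u0 = pmeet EA CB (EA.osub u (projCoverq EA CB u d)) u ∧
      u1 = pmeet EA CB u (EA.compl u0) ∧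
      c0 = EA.oplusD (CB.J u0 c) (CB.J u0 c) ∧
      u0 ∈ CB.P ∧ u1 ∈ CB.P ∧ EA.padd u0 u1 = some u ∧ EA.le d u1 ∧ EA.le c0 u0 ∧
      (∀ q ∈ CB.P, inC EA CB c q → inC EA CB u q →
        inC EA CB u0 q ∧ inC EA CB u1 q ∧ inC EA CB d q ∧ inC EA CB c0 q) ∧
      (∀ t : E → ℝ, (∀ a b c, EA.padd a b = some c → t c = t a + t b) →
        2 * t c = t c0 + t u1 + t d) := by
  have hne := Pleq_nonempty hspec hu hc
  obtain ⟨d, hd⟩ : ∃ d, d = posPartq EA CB u (EA.osub u c) c := ⟨_, rfl⟩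
  have hd2 := hd
  rw [posPartq, dif_pos hne] at hd2
  obtain ⟨hp, hp1, hp2⟩ := hne.some_mem
  set p := hne.some with hpdef
  clear_value p
  have hs := osub_spec hc
  set c' := EA.osub u c with hc'
  clear_value c'
  have hs' : EA.padd c' c = some u := by rw [EA.comm]; exact hs
  have hc'u : EA.le c' u := le_right hs
  have hpP := hp.1.1
  have hpu : EA.le p u := hp.1.2
  have hcp : inC EA CB c p := (inCq_iff' hu hpP hpu hc).1 (hp.2 c (Or.inr (Or.inr rfl)))
  have hcp' : inC EA CB c' p := (inCq_iff' hu hpP hpu hc'u).1 (hp.2 c' (Or.inr (Or.inl rfl)))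
  have hds := osub_spec hp1
  rw [← hd2] at hds
  have hrel := rel hu hpP (C_le hu hpu)
  rw [J_fix hu hpu] at hrel
  rw [(hrel.2 _ hc).2, (hrel.2 _ hc'u).2] at hp2
  have hdp : EA.le d p := le_tr (le_right hds) (J_le hpP c)
  have hdu := le_tr hdp hpu
  -- the cover
  obtain ⟨u1, hu1⟩ : ∃ u1, u1 = projCover EA CB d := ⟨_, rfl⟩
  have hu1P : u1 ∈ CB.P := by rw [hu1]; exact (cover_spec hspec d).1
  have hu1p : EA.le u1 p := by rw [hu1]; exact cover_le hspec hpP hdp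
  have hdu1 : EA.le d u1 := by rw [hu1]; exact le_cover hspec d
  have hu1u := le_tr hu1p hpu
  have key : ∀ q ∈ CB.P, inC EA CB c q → inC EA CB u q →
      inC EA CB u1 q ∧ inC EA CB d q := by
    intro q hq h1 h2
    have h2' := C_symm hu hq h2
    have h3 : inC EA CB c' q := C_sub hq h1 h2 hs
    have hr := rel hu hq h2'
    have h4 : inCq EA CB u (CB.J u q) p := by
      refine hp.2 _ (Or.inl ⟨hr.1, ?_⟩)
      rintro a (rfl | rfl)
      · exact (inCq_iff hu hq h2' hc'u).2 h3
      · exact (inCq_iff hu hq h2' hc).2 h1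
    have h5 := C_symm hr.1.1 hpP ((inCq_iff' hu hpP hpu hr.1.2).1 h4)
    have h6 : inC EA CB p q :=
      (inCq_iff hu hq h2' hpu).1 ((inCq_iff' hu hr.1.1 hr.1.2 hpu).2 h5)
    have h7 : inC EA CB d q := C_sub hq (C_J hpP hq h6 h3) (C_J hpP hq h6 h1) hds
    exact ⟨by rw [hu1]; exact C_cover hspec hq h7, h7⟩
  have hcu1 : inC EA CB c u1 := by
    obtain ⟨B, hB, hB2⟩ := hspec.2.1 c
    rw [hB2 u1 hu1P]
    intro b hb
    have hbP := hB.1 hb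
    have hcb : inC EA CB c b := by
      rw [hB2 b hbP]
      intro b2 hb2
      obtain ⟨x, _, y, _, z, _, d, e, h⟩ := hB.2.2 b2 hb2 b hb
      exact C_of_Mackey hbP ⟨x, y, z, d, e, h⟩
    have hbu := (hB2 u hu).1 (C_le hu hc) b hb
    exact C_symm hu1P hbP (key b hbP hcb (C_symm hbP hu hbu)).1
  -- u0
  have hu01 := osub_spec hu1u
  obtain ⟨u0, hu0⟩ : ∃ u0, u0 = EA.osub u u1 := ⟨_, rfl⟩
  rw [← hu0] at hu01
  have hu0P : u0 ∈ CB.P := P_sub hu1P hu hu01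
  have hu0u : EA.le u0 u := le_right hu01
  have hu10 : EA.padd u0 u1 = some u := by rw [EA.comm]; exact hu01
  have hm0 : pmeet EA CB (EA.osub u (projCoverq EA CB u d)) u = u0 := by
    rw [projCoverq_eq hspec hu hdu, ← hu1, ← hu0]
    exact pmeet_eq ⟨hu0P, le_rfl' _, hu0u, fun s _ h _ => h⟩
  have hm1 : pmeet EA CB u (EA.compl u0) = u1 := by
    refine pmeet_eq ⟨hu1P, hu1u, orth_le hu01, fun s hs h1 h2 => ?_⟩
    obtain ⟨z, hz⟩ := orth_of_le h2
    have h3 := J_mono hu h2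
    rw [J_fix hu h1] at h3
    have h4 := J_add hu (compl_spec (EA := EA) u0)
    rw [J_fix hu hu0u, CB.focus u hu] at h4
    rwa [cancel h4 hu10] at h3
  have hrel1 := rel hu hu1P (C_le hu hu1u)
  rw [J_fix hu hu1u, ← hu0] at hrel1
  have hcs : EA.padd (CB.J u1 c) (CB.J u0 c) = some c := by
    rw [(hrel1.2 c hc).2]; exact hcu1
  have hu0s : EA.padd (CB.J u0 c) (CB.J u0 c') = some u0 := by
    have := J_add hu0P hs
    rwa [J_above hu0P hu0u] at this
  have hle : EA.le (CB.J u0 c) (CB.J u0 c') := by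
    have h1 := J_add hu0P hcp
    have h2 := J_add hu0P hcp'
    have h3 := J_add hu0P hds
    rw [(J_zero_iff hu0P d).2 (le_tr hdu1 (orth_le hu01)), add_zero] at h3
    rw [← Option.some.inj h3] at h1
    exact add_le_add_l h1 h2 (J_mono hu0P hp2)
  obtain ⟨c0, hc0⟩ := orth_mono hu0s (le_rfl' _) hle
  have hc0u0 : EA.le c0 u0 := add_le_add_l hc0 hu0s hle
  refine ⟨d, u0, u1, c0, hd, hm0.symm, hm1.symm, ?_, hu0P, hu1P, hu10, hdu1, hc0u0, ?_, ?_⟩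
  · simp [oplusD, hc0]
  · intro q hq h1 h2
    obtain ⟨k1, k2⟩ := key q hq h1 h2
    have k3 : inC EA CB u0 q := C_sub hq k1 h2 hu01
    have k4 := C_J hu0P hq k3 h1
    exact ⟨k3, k1, k2, C_add hq k4 k4 hc0⟩
  · intro t ht
    have e1 := ht _ _ _ hcs
    have e2 := ht _ _ _ hc0
    have hpc : ∀ x, CB.J u1 (CB.J p x) = CB.J u1 x := by
      intro x
      have := (com hu1P hpP (C_le hpP hu1p)).2.2.1 x
      rwa [J_above hu1P hu1p] at this
    have h3 := J_add hu1P hds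
    rw [hpc, hpc, J_fix hu1P hdu1] at h3
    have e3 := ht _ _ _ h3
    have h4 := J_add hu1P hs
    rw [J_above hu1P hu1u] at h4
    have e4 := ht _ _ _ h4
    linarith

/-! the families `u_w`, `c_w` -/

theorem uw_nil (a : E) : uw EA CB a [] = projCover EA CB a := rfl

theorem cw_nil (a : E) : cw EA CB a [] = a := rfl

theorem uc_inv (hspec : Spectral EA CB) (a : E) (w : List Bool) :
    (ucAux EA CB a w).1 ∈ CB.P ∧ EA.le (ucAux EA CB a w).2 (ucAux EA CB a w).1 := by
  induction w with
  | nil => exact ⟨(cover_spec hspec a).1, le_cover hspec a⟩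
  | cons b t ih =>
    obtain ⟨d, u0, u1, c0, h1, h2, h3, h4, h5, h6, _, h7, h8, _⟩ := step hspec ih.1 ih.2
    cases b
    · simp only [ucAux, ← h1, ← h2, ← h3, ← h4]
      exact ⟨h5, h8⟩
    · simp only [ucAux, ← h1, ← h2, ← h3, ← h4]
      exact ⟨h6, h7⟩

theorem uw_mem (hspec : Spectral EA CB) (a : E) (w : List Bool) : uw EA CB a w ∈ CB.P :=
  (uc_inv hspec a _).1

theorem cw_le (hspec : Spectral EA CB) (a : E) (w : List Bool) :
    EA.le (cw EA CB a w) (uw EA CB a w) := (uc_inv hspec a _).2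

theorem uc_step (hspec : Spectral EA CB) (a : E) (w : List Bool) :
    EA.padd (uw EA CB a (w ++ [false])) (uw EA CB a (w ++ [true])) = some (uw EA CB a w) ∧
    (∀ q ∈ CB.P, inC EA CB (cw EA CB a w) q → inC EA CB (uw EA CB a w) q →
      inC EA CB (uw EA CB a (w ++ [false])) q ∧ inC EA CB (uw EA CB a (w ++ [true])) q ∧
      inC EA CB (cw EA CB a (w ++ [true])) q ∧ inC EA CB (cw EA CB a (w ++ [false])) q) ∧
    (∀ t : E → ℝ, (∀ a b c, EA.padd a b = some c → t c = t a + t b) →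
        2 * t (cw EA CB a w) = t (cw EA CB a (w ++ [false])) + t (uw EA CB a (w ++ [true])) +
          t (cw EA CB a (w ++ [true]))) := by
  have ih := uc_inv hspec a w.reverse
  obtain ⟨d, u0, u1, c0, h1, h2, h3, h4, h5, h6, h7, _, _, h8, h9⟩ := step hspec ih.1 ih.2
  simp only [uw, cw, List.reverse_append, List.reverse_cons, List.reverse_nil, List.nil_append,
    List.cons_append, ucAux, ← h1, ← h2, ← h3, ← h4]
  exact ⟨h7, h8, h9⟩

theorem uc_C (hspec : Spectral EA CB) (a : E) {q : E} (hq : q ∈ CB.P) (ha : inC EA CB a q)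
    (w : List Bool) : inC EA CB (uw EA CB a w) q ∧ inC EA CB (cw EA CB a w) q := by
  induction w using List.reverseRecOn with
  | nil => exact ⟨C_cover hspec hq ha, ha⟩
  | append_singleton t b ih =>
    have := (uc_step hspec a t).2.1 q hq ih.2 ih.1
    cases b
    · exact ⟨this.1, this.2.2.2⟩
    · exact ⟨this.2.1, this.2.2.1⟩

/-! orthogonal sums of lists -/

inductive Sums (EA : EffectAlgebra E) : List E → E → Prop
  | nil : Sums EA [] EA.zero
  | cons {l : List E} {x y z : E} : Sums EA l x → EA.padd y x = some z → Sums EA (y :: l) z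

theorem Sums.sublist {l : List E} {x : E} (h : Sums EA l x) {l' : List E}
    (hl : l'.Sublist l) : ∃ x', EA.le x' x ∧ Sums EA l' x' := by
  induction h generalizing l' with
  | nil =>
    rw [List.sublist_nil] at hl
    subst hl
    exact ⟨_, le_rfl' _, Sums.nil⟩
  | cons hs hp ih =>
    cases hl with
    | cons _ h =>
      obtain ⟨x', h1, h2⟩ := ih h
      exact ⟨x', le_tr h1 (le_right hp), h2⟩
    | cons_cons _ h =>
      obtain ⟨x', h1, h2⟩ := ih h
      obtain ⟨z, hz⟩ := orth_mono hp (le_rfl' _) h1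
      exact ⟨z, add_le_add_l hz hp h1, Sums.cons h2 hz⟩

theorem Sums.foldl {l : List E} {x : E} (h : Sums EA l x) {acc z : E}
    (hz : EA.padd acc x = some z) : l.foldl (fun acc x => EA.oplusD acc x) acc = z := by
  induction h generalizing acc z with
  | nil =>
    rw [add_zero] at hz
    exact Option.some.inj hz
  | cons hs hp ih =>
    obtain ⟨m, hm, hm'⟩ := assoc' hp hz
    rw [List.foldl_cons]
    simp only [oplusD, hm, Option.getD_some]
    exact ih hm'

theorem Sums.state {l : List E} {x : E} (h : Sums EA l x) {t : E → ℝ}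
    (ht : ∀ a b c, EA.padd a b = some c → t c = t a + t b) : t x = (l.map t).sum := by
  induction h with
  | nil =>
    have := ht _ _ _ (add_zero (EA := EA) EA.zero)
    simp; linarith
  | cons hs hp ih =>
    rw [ht _ _ _ hp, ih]; simp

theorem Sums.C {q : E} (hq : q ∈ CB.P) {l : List E} {x : E} (h : Sums EA l x)
    (hl : ∀ y ∈ l, inC EA CB y q) : inC EA CB x q := by
  induction h with
  | nil => exact C_le hq (zero_le q)
  | cons hs hp ih =>
    exact C_add hq (hl _ (by simp)) (ih fun y hy => hl y (by simp [hy])) hp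

theorem Sums.refine {f : List Bool → E}
    (hf : ∀ w, EA.padd (f (w ++ [false])) (f (w ++ [true])) = some (f w))
    (l : List (List Bool)) {x : E} (h : Sums EA (l.map f) x) :
    Sums EA ((l.flatMap fun w => [w ++ [false], w ++ [true]]).map f) x := by
  induction l generalizing x with
  | nil => exact h
  | cons w l ih =>
    cases h with
    | cons hs hp =>
      obtain ⟨m, hm, hm'⟩ := EA.assoc _ _ _ _ _ (hf w) hp
      exact Sums.cons (Sums.cons (ih hs) hm) hm'

theorem Sums.all (hspec : Spectral EA CB) (a : E) (n : ℕ) :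
    Sums EA ((allStrings n).map (uw EA CB a)) (projCover EA CB a) := by
  induction n with
  | zero => exact Sums.cons Sums.nil (add_zero _)
  | succ n ih => exact Sums.refine (fun w => (uc_step hspec a w).1) _ ih

theorem pbin_sums (hspec : Spectral EA CB) (a : E) (w : List Bool) :
    Sums EA (EA.compl (projCover EA CB a) ::
    (((allStrings (w.length + 1)).filter
        fun v => lamOf v ≤ lamOf (w ++ [false])).map (uw EA CB a))) (pbin EA CB a w) := by
  obtain ⟨x, hx, hs⟩ := (Sums.all hspec a (w.length + 1)).sublist
    ((List.filter_sublist (p := fun v => decide (lamOf v ≤ lamOf (w ++ [false])))).map (uw EA CB a))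
  obtain ⟨z, hz⟩ := orth_mono (by rw [EA.comm]; exact compl_spec (EA := EA) (projCover EA CB a))
    (le_rfl' (EA.compl (projCover EA CB a))) hx
  have h := Sums.cons hs hz
  have e := h.foldl (zero_add z)
  unfold pbin listSum
  rw [e]
  exact h

/-! binary strings -/

theorem lam_bd (w : List Bool) : 0 ≤ lamOf w ∧ lamOf w ≤ 1 - (1 / 2) ^ w.length := by
  induction w with
  | nil => simp [lamOf]
  | cons b t ih =>
    have h : (0 : ℚ) < (1 / 2) ^ t.length := by positivity
    cases b <;> simp only [lamOf, List.length_cons, pow_succ] <;> constructor <;> norm_num at * <;>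
      linarith

theorem lam_lt (w : List Bool) : lamOf w < 1 := by
  have := (lam_bd w).2
  have h : (0 : ℚ) < (1 / 2) ^ w.length := by positivity
  linarith

theorem lam_append (w : List Bool) (b : Bool) :
    lamOf (w ++ [b]) = lamOf w + (if b then 1 else 0) * (1 / 2) ^ (w.length + 1) := by
  induction w with
  | nil => simp [lamOf]; split <;> norm_num
  | cons c t ih =>
    simp only [List.cons_append, lamOf, ih, List.length_cons]
    ring

theorem lam_true_pos (w : List Bool) : 0 < lamOf (w ++ [true]) := by
  rw [lam_append]
  have := (lam_bd w).1
  have h : (0 : ℚ) < (1 / 2) ^ (w.length + 1) := by positivity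
  simp only [if_true]; linarith

theorem lam_inj (w v : List Bool) (h : lamOf (w ++ [true]) = lamOf (v ++ [true])) : w = v := by
  induction w generalizing v with
  | nil =>
    cases v with
    | nil => rfl
    | cons b t =>
      exfalso
      have h1 := lam_true_pos t
      have h2 := lam_lt (t ++ [true])
      cases b <;> simp [lamOf] at h <;> linarith
  | cons b t ih =>
    have h1 := lam_true_pos t
    have h2 := lam_lt (t ++ [true])
    cases v with
    | nil =>
      exfalso
      cases b <;> simp [lamOf] at h <;> linarith
    | cons b' t' =>
      have h3 := lam_true_pos t'
      have h4 := lam_lt (t' ++ [true])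
      simp only [List.cons_append, lamOf] at h
      cases b <;> cases b' <;> simp at h
      · rw [ih t' (by linarith)]
      · linarith
      · linarith
      · rw [ih t' (by linarith)]

theorem lam_sep (v w : List Bool) (hl : v.length = w.length) (h1 : lamOf v ≤ lamOf w)
    (h2 : lamOf w < lamOf v + (1 / 2) ^ (v.length + 1)) : v = w := by
  induction v generalizing w with
  | nil => cases w with
    | nil => rfl
    | cons _ _ => simp at hl
  | cons b t ih =>
    cases w with
    | nil => simp at hl
    | cons b' t' =>
      have hl' : t.length = t'.length := by simpa using hl
      have h3 := lam_bd t
      have h4 := lam_bd t'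
      have h5 := lam_lt t'
      have h6 : (0 : ℚ) < (1 / 2) ^ t.length := by positivity
      simp only [lamOf, List.length_cons, pow_succ] at h1 h2
      have := ih t' hl'
      rw [pow_succ] at this
      cases b <;> cases b' <;> simp only [if_true, Bool.false_eq_true, if_false] at h1 h2
      · rw [this (by linarith) (by linarith)]
      · linarith
      · linarith
      · rw [this (by linarith) (by linarith)]

theorem mem_all (n : ℕ) (w : List Bool) : w ∈ allStrings n ↔ w.length = n := by
  induction n generalizing w with
  | zero => simp [allStrings]
  | succ n ih =>
    simp only [allStrings, List.mem_flatMap, ih, List.mem_cons, List.not_mem_nil, or_false]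
    constructor
    · rintro ⟨v, hv, rfl | rfl⟩ <;> simp [hv]
    · intro h
      rcases List.eq_nil_or_concat w with rfl | ⟨v, b, rfl⟩
      · simp at h
      · refine ⟨v, by simpa using h, ?_⟩
        cases b <;> simp

theorem nodup_all (n : ℕ) : (allStrings n).Nodup := by
  induction n with
  | zero => simp [allStrings]
  | succ n ih =>
    rw [allStrings, List.nodup_flatMap]
    refine ⟨fun w _ => by simp, ih.imp ?_⟩
    intro v w hvw
    simp [Function.onFun, hvw, Ne.symm hvw]

theorem sum_flat (l : List (List Bool)) (f : List Bool → ℝ) :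
    ((l.flatMap fun w => [w ++ [false], w ++ [true]]).map f).sum =
      (l.map fun w => f (w ++ [false]) + f (w ++ [true])).sum := by
  induction l with
  | nil => rfl
  | cons w l ih =>
    simp only [List.flatMap_cons, List.map_append, List.sum_append, ih, List.map_cons,
      List.sum_cons, List.map_nil, List.sum_nil]
    ring

theorem sum_filt (l : List (List Bool)) (p : List Bool → Prop) [DecidablePred p]
    (f : List Bool → ℝ) :
    ((l.filter fun v => p v).map f).sum = (l.map fun v => if p v then f v else 0).sum := by
  induction l with
  | nil => rfl
  | cons w l ih =>
    by_cases h : p w <;> simp [List.filter_cons, h, ih]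

theorem sum_single (l : List (List Bool)) (hl : l.Nodup) (w : List Bool) (hw : w ∈ l)
    (f : List Bool → ℝ) (h : ∀ v ∈ l, v ≠ w → f v = 0) : (l.map f).sum = f w := by
  rw [← List.sum_toFinset f hl]
  exact Finset.sum_eq_single w (fun v hv hne => h v (by simpa using hv) hne)
    (fun h' => absurd (by simpa using hw) h')

theorem sum_sub (l : List (List Bool)) (f g : List Bool → ℝ) :
    (l.map fun v => f v - g v).sum = (l.map f).sum - (l.map g).sum := by
  induction l with
  | nil => simp
  | cons w l ih => simp [ih]; ring

/-- a function on strings is determined by its initial sums -/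
theorem strings_zero (h : List Bool → ℝ) (h0 : h [] = 0)
    (hadd : ∀ w, h (w ++ [false]) + h (w ++ [true]) = h w)
    (hsum : ∀ w, (((allStrings (w.length + 1)).filter
        fun v => lamOf v ≤ lamOf (w ++ [false])).map h).sum = 0) (w : List Bool) : h w = 0 := by
  have main : ∀ n, ∀ w : List Bool, w.length = n → h w = 0 := by
    intro n
    induction n with
    | zero => intro w hw; rw [List.length_eq_zero_iff.1 hw]; exact h0
    | succ n ih =>
      have key : ∀ w : List Bool, w.length = n → h (w ++ [false]) = 0 := by
        intro w hw
        have hs := hsum w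
        rw [sum_filt, allStrings, sum_flat, hw, sum_single _ (nodup_all n) w ((mem_all n w).2 hw)]
          at hs
        · have hpos : (0 : ℚ) < (1 / 2) ^ (w.length + 1) := by positivity
          have hn : ¬ (lamOf (w ++ [true]) ≤ lamOf (w ++ [false])) := by
            rw [lam_append, lam_append]; simp only [if_true, Bool.false_eq_true, if_false]
            linarith
          rw [if_pos (_root_.le_refl _), if_neg hn] at hs
          linarith
        · intro v hv hne
          have hvl := (mem_all n v).1 hv
          have hv0 := hadd v
          rw [ih v hvl] at hv0
          have e1 : (lamOf (v ++ [false]) ≤ lamOf (w ++ [false])) ↔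
              (lamOf (v ++ [true]) ≤ lamOf (w ++ [false])) := by
            have hpos : (0 : ℚ) < (1 / 2) ^ (v.length + 1) := by positivity
            simp only [lam_append, if_true, Bool.false_eq_true, if_false]
            constructor
            · intro hle
              by_contra hlt
              exact hne (lam_sep v w (by omega) (by linarith) (by linarith))
            · intro hle; linarith
          by_cases hc : lamOf (v ++ [true]) ≤ lamOf (w ++ [false])
          · rw [if_pos (e1.2 hc), if_pos hc]; exact hv0
          · rw [if_neg (fun h => hc (e1.1 h)), if_neg hc]; norm_num
      intro w hw
      rcases List.eq_nil_or_concat w with rfl | ⟨v, b, rfl⟩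
      · simp at hw
      · have hv : v.length = n := by simpa using hw
        have h1 := key v hv
        have h2 := hadd v
        rw [ih v hv] at h2
        cases b
        · simpa using h1
        · have : h (v ++ [true]) = 0 := by linarith
          simpa using this
  exact main _ w rfl

theorem pdyad_zero (a : E) : pdyad EA CB a (lamOf []) = EA.compl (projCover EA CB a) := by
  simp [pdyad, lamOf]

theorem pdyad_true (a : E) (w : List Bool) :
    pdyad EA CB a (lamOf (w ++ [true])) = pbin EA CB a w := by
  have h : ∃ v : List Bool, lamOf (v ++ [true]) = lamOf (w ++ [true]) := ⟨w, rfl⟩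
  rw [pdyad, if_neg (not_le.2 (lam_true_pos w)), if_neg (not_le.2 (lam_lt _)), dif_pos h,
    lam_inj _ _ h.choose_spec]

theorem state_expand (hspec : Spectral EA CB) (a : E) {t : E → ℝ}
    (ht : ∀ a b c, EA.padd a b = some c → t c = t a + t b) (n : ℕ) :
    t a = ((allStrings n).map fun w =>
      (lamOf w : ℝ) * t (uw EA CB a w) + (1 / 2) ^ n * t (cw EA CB a w)).sum := by
  induction n with
  | zero => simp [allStrings, lamOf, cw_nil]
  | succ n ih =>
    rw [ih, allStrings, sum_flat]
    congr 1
    apply List.map_congr_left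
    intro w hw
    have hl := (mem_all n w).1 hw
    have h1 := ht _ _ _ (uc_step hspec a w).1
    have h2 := (uc_step hspec a w).2.2 t ht
    rw [lam_append, lam_append, hl, h1]
    simp only [if_true, Bool.false_eq_true, if_false]
    push_cast
    rw [pow_succ]
    linear_combination (1 / 2 : ℝ) ^ n * (1 / 2) * h2

theorem state_rest (hspec : Spectral EA CB) (a : E) {t : E → ℝ} (ht : EA.IsState t) (n : ℕ) :
    0 ≤ ((allStrings n).map fun w => t (cw EA CB a w)).sum ∧
    ((allStrings n).map fun w => t (cw EA CB a w)).sum ≤ 1 := by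
  constructor
  · apply List.sum_nonneg
    intro x hx
    obtain ⟨w, _, rfl⟩ := List.mem_map.1 hx
    exact (ht.2.1 _).1
  · have h := (Sums.all hspec a n).state ht.2.2
    rw [List.map_map] at h
    refine le_trans ?_ (le_trans h.ge (ht.2.1 _).2)
    apply List.sum_le_sum
    intro w _
    obtain ⟨x, hx⟩ := cw_le hspec a w
    have := ht.2.2 _ _ _ hx
    have := (ht.2.1 x).1
    simp only [Function.comp]
    linarith

theorem states_eq (hspec : Spectral EA CB) (a b : E) {t1 t2 : E → ℝ}
    (h1 : EA.IsState t1) (h2 : EA.IsState t2)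
    (h : ∀ w, t1 (pdyad EA CB a (lamOf w)) = t2 (pdyad EA CB b (lamOf w))) : t1 a = t2 b := by
  have hc : t1 (EA.compl (projCover EA CB a)) = t2 (EA.compl (projCover EA CB b)) := by
    have := h []
    rwa [pdyad_zero, pdyad_zero] at this
  have hu : ∀ w, t1 (uw EA CB a w) - t2 (uw EA CB b w) = 0 := by
    apply strings_zero (fun w => t1 (uw EA CB a w) - t2 (uw EA CB b w))
    · have e1 := h1.2.2 _ _ _ (compl_spec (projCover EA CB a))
      have e2 := h2.2.2 _ _ _ (compl_spec (projCover EA CB b))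
      rw [h1.1] at e1
      rw [h2.1] at e2
      simp only [uw_nil]
      linarith
    · intro w
      have e1 := h1.2.2 _ _ _ (uc_step hspec a w).1
      have e2 := h2.2.2 _ _ _ (uc_step hspec b w).1
      linarith
    · intro w
      have e := h (w ++ [true])
      rw [pdyad_true, pdyad_true, (pbin_sums hspec a w).state h1.2.2,
        (pbin_sums hspec b w).state h2.2.2] at e
      simp only [List.map_cons, List.sum_cons, List.map_map, hc] at e
      rw [sum_sub]
      have e' := add_left_cancel e
      exact sub_eq_zero.2 e'
  have hn : ∀ n : ℕ, |t1 a - t2 b| ≤ (1 / 2) ^ n := by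
    intro n
    rw [state_expand hspec a h1.2.2 n, state_expand hspec b h2.2.2 n, ← sum_sub]
    have : ((allStrings n).map fun w =>
        ((lamOf w : ℝ) * t1 (uw EA CB a w) + (1 / 2) ^ n * t1 (cw EA CB a w)) -
        ((lamOf w : ℝ) * t2 (uw EA CB b w) + (1 / 2) ^ n * t2 (cw EA CB b w))) =
        (allStrings n).map fun w => (1 / 2) ^ n * (t1 (cw EA CB a w) - t2 (cw EA CB b w)) := by
      apply List.map_congr_left
      intro w _
      linear_combination (lamOf w : ℝ) * hu w
    rw [this, List.sum_map_mul_left, sum_sub, abs_mul, abs_of_pos (by positivity)]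
    obtain ⟨r1, r2⟩ := state_rest hspec a h1 n
    obtain ⟨r3, r4⟩ := state_rest hspec b h2 n
    refine mul_le_of_le_one_right (by positivity) (abs_le.2 ⟨by linarith, by linarith⟩)
  by_contra hne
  have hpos : 0 < |t1 a - t2 b| := abs_pos.2 (sub_ne_zero.2 hne)
  obtain ⟨n, hlt⟩ := exists_pow_lt_of_lt_one hpos (by norm_num : (1 / 2 : ℝ) < 1)
  exact absurd (hn n) (not_le.2 hlt)

theorem state_comp {q : E} (hq : q ∈ CB.P) {s : E → ℝ} (hs : EA.IsState s) :
    EA.IsState (fun x => s (CB.J q x) + s (CB.J (EA.compl q) x)) := by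
  refine ⟨?_, fun a => ⟨add_nonneg (hs.2.1 _).1 (hs.2.1 _).1, ?_⟩, ?_⟩
  · simp only [CB.focus q hq, CB.focus _ (P_compl hq)]
    rw [← hs.2.2 _ _ _ (compl_spec q), hs.1]
  · obtain ⟨z, hz⟩ := J_orth hq a a
    simp only
    rw [← hs.2.2 _ _ _ hz]
    exact (hs.2.1 _).2
  · intro a b c h
    simp only
    rw [hs.2.2 _ _ _ (J_add hq h), hs.2.2 _ _ _ (J_add (P_compl hq) h)]
    ring

theorem pdyad_C (hspec : Spectral EA CB) {a q : E} (hq : q ∈ CB.P) (ha : inC EA CB a q) (x : ℚ) :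
    inC EA CB (pdyad EA CB a x) q := by
  have hcov := C_compl hq (C_cover hspec hq ha)
  unfold pdyad
  split
  · exact hcov
  · split
    · exact C_one hq
    · split
      · refine (pbin_sums hspec a _).C hq ?_
        intro y hy
        rcases List.mem_cons.1 hy with rfl | hy
        · exact hcov
        · obtain ⟨w, _, rfl⟩ := List.mem_map.1 hy
          exact (uc_C hspec a hq ha w).1
      · exact C_le hq (zero_le q)

end helpers

end EffectAlgebra

open EffectAlgebra in
/-- in a spectral effect algebra with a separating set of states:
(i) for `q ∈ P` and `a ∈ E`, `a ∈ C(q)` iff `p_{a,λ(w)} ∈ C(q)` for every binary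
string `w`; (ii) elements with the same binary spectral resolution are equal. -/
theorem statement15 {E : Type u} (EA : EffectAlgebra E) (CB : CompressionBase EA)
    (hspec : Spectral EA CB)
    (S : Set (E → ℝ)) (hS : ∀ s ∈ S, EA.IsState s)
    (hsep : ∀ a b : E, (∀ s ∈ S, s a = s b) → a = b) :
    (∀ q ∈ CB.P, ∀ a : E,
      inC EA CB a q ↔ ∀ w : List Bool, inC EA CB (pdyad EA CB a (lamOf w)) q) ∧
    (∀ a b : E,
      (∀ w : List Bool, pdyad EA CB a (lamOf w) = pdyad EA CB b (lamOf w)) → a = b) := by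
  refine ⟨fun q hq a => ⟨fun ha w => pdyad_C hspec hq ha _, fun h => ?_⟩, fun a b h => ?_⟩
  · obtain ⟨z, hz⟩ := J_orth hq a a
    have : z = a := by
      apply hsep
      intro s hs
      rw [(hS s hs).2.2 _ _ _ hz]
      refine states_eq hspec a a (state_comp hq (hS s hs)) (hS s hs) fun w => ?_
      exact ((hS s hs).2.2 _ _ _ (h w)).symm
    rw [this] at hz
    exact hz
  · apply hsep
    intro s hs
    exact states_eq hspec a b (hS s hs) (hS s hs) fun w => by rw [h w]
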